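/- There exists an absolute constant c > 0, independent of k and of the choices of the intervals I(J), such that for every integer k > 4000 there exists a subinterval R_k of [0,1) with ‖w_k‖*_{R_k} ≥ c·3^k·⟨w_k⟩_{R_k} and ⟨w_k⟩_{R_k}·⟨σ_k⟩_{R_k} ≥ c. -/

import Mathlib

open MeasureTheory Set Filter

noncomputable section

namespace RTpaper

/-- The half-open interval `[a, b)` represented by the pair `(a, b)`. -/
def ivSet (I : ℝ × ℝ) : Set ℝ := Set.Ico I.1 I.2

/-- The length of the interval represented by `I`. -/
def len (I : ℝ × ℝ) : ℝ := I.2 - I.1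

/-- The middle triadic child of an interval. -/
def mid (I : ℝ × ℝ) : ℝ × ℝ := (I.1 + (I.2 - I.1) / 3, I.2 - (I.2 - I.1) / 3)

/-- The families `𝐊ᵢ` of the Reguera–Thiele construction. -/
def Kfam (k : ℕ) : ℕ → Set (ℝ × ℝ)
  | 0 => {((0 : ℝ), (1 : ℝ))}
  | (i + 1) =>
      {I | ∃ K ∈ Kfam k i, ∃ j : ℕ, j < 3 ^ (k - 1) ∧
        I = ((mid K).1 + (j : ℝ) * ((3 : ℝ) ^ (1 - (k : ℤ)) * len (mid K)),
             (mid K).1 + ((j : ℝ) + 1) * ((3 : ℝ) ^ (1 - (k : ℤ)) * len (mid K)))}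

/-- The families `𝐉ᵢ` (of interest for `i ≥ 1`). -/
def Jfam (k i : ℕ) : Set (ℝ × ℝ) := {J | ∃ K ∈ Kfam k (i - 1), J = mid K}

/-- The family `𝐊 = ⋃ᵢ 𝐊ᵢ`. -/
def KK (k : ℕ) : Set (ℝ × ℝ) := ⋃ i, Kfam k i

/-- The family `𝐉 = ⋃_{i ≥ 1} 𝐉ᵢ`. -/
def JJ (k : ℕ) : Set (ℝ × ℝ) := ⋃ i, Jfam k (i + 1)

/-- The chosen triadic interval `I(J)` adjacent to `J` of length `3^{1-k}|J|`, encoded by a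
choice function `ch` deciding, for each `J`, whether `I(J)` lies to the right (`true`) or to
the left (`false`) of `J`. -/
def IJ (k : ℕ) (ch : ℝ × ℝ → Bool) (J : ℝ × ℝ) : ℝ × ℝ :=
  if ch J then (J.2, J.2 + (3 : ℝ) ^ (1 - (k : ℤ)) * len J)
  else (J.1 - (3 : ℝ) ^ (1 - (k : ℤ)) * len J, J.1)

/-- The weight `w_k = Σ_{i ≥ 1} Σ_{J ∈ 𝐉ᵢ} (3^k/(3^{k-1}+1))^i · 1_{I(J)}`. -/
def wgt (k : ℕ) (ch : ℝ × ℝ → Bool) (x : ℝ) : ℝ :=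
  ∑' i : ℕ, ∑' J : ↥(Jfam k (i + 1)),
    Set.indicator (ivSet (IJ k ch (J : ℝ × ℝ)))
      (fun _ => ((3 : ℝ) ^ k / ((3 : ℝ) ^ (k - 1) + 1)) ^ (i + 1)) x

/-- The weight `σ_k = w_k^{1-p}` on `{w_k > 0}`, and `0` elsewhere. -/
def sgm (p : ℝ) (k : ℕ) (ch : ℝ × ℝ → Bool) (x : ℝ) : ℝ :=
  if 0 < wgt k ch x then wgt k ch x ^ (1 - p) else 0

/-- `u(I) = ∫_I u`. -/
def mass (u : ℝ → ℝ) (I : ℝ × ℝ) : ℝ := ∫ x in ivSet I, u x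

/-- `⟨u⟩_I = u(I)/|I|`. -/
def avg (u : ℝ → ℝ) (I : ℝ × ℝ) : ℝ := mass u I / len I

/-- `ch_𝐊(K)`: the members of `𝐊_{i+1}` contained in `K ∈ 𝐊ᵢ`. -/
def chK (k : ℕ) (K : ℝ × ℝ) : Set (ℝ × ℝ) :=
  {K' | ∃ i, K ∈ Kfam k i ∧ K' ∈ Kfam k (i + 1) ∧ ivSet K' ⊆ ivSet K}

/-- Triadic intervals of `ℝ`. -/
def IsTriadic (I : ℝ × ℝ) : Prop :=
  ∃ n j : ℤ, I.1 = (j : ℝ) * (3 : ℝ) ^ (-n) ∧ I.2 = ((j : ℝ) + 1) * (3 : ℝ) ^ (-n)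

/-- Maximal members of `S` strictly contained in `R`. -/
def maxIn (S : Set (ℝ × ℝ)) (R : ℝ × ℝ) : Set (ℝ × ℝ) :=
  {Q | Q ∈ S ∧ ivSet Q ⊂ ivSet R ∧
    ∀ Q' ∈ S, ivSet Q ⊆ ivSet Q' → ivSet Q' ⊂ ivSet R → ivSet Q' = ivSet Q}

/-- Martingale `ε`-sparse families of (half-open) intervals. -/
def MSparse (ε : ℝ) (S : Set (ℝ × ℝ)) : Prop :=
  S.Countable ∧ (∀ I ∈ S, I.1 < I.2) ∧
    (∀ I ∈ S, ∀ J ∈ S, ivSet I ⊆ ivSet J ∨ ivSet J ⊆ ivSet I ∨ ivSet I ∩ ivSet J = ∅) ∧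
    ∀ R ∈ S, (∑' Q : ↥(maxIn S R), len (Q : ℝ × ℝ)) ≤ ε * len R

/-- `Σ_{I ∈ F} ⟨u⟩_I^q · ⟨v⟩_I · |I|`. -/
def sumTest (q : ℝ) (u v : ℝ → ℝ) (F : Set (ℝ × ℝ)) : ℝ :=
  ∑' I : ↥F, avg u (I : ℝ × ℝ) ^ q * avg v (I : ℝ × ℝ) * len (I : ℝ × ℝ)


/-- The weight `σ_k = 1/w_k` on `{w_k > 0}`, and `0` elsewhere (case `p = 2`). -/
def sgm2 (k : ℕ) (ch : ℝ × ℝ → Bool) (x : ℝ) : ℝ :=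
  if 0 < wgt k ch x then (wgt k ch x)⁻¹ else 0

/-- The Lorentz quasinorm `‖f‖_{Λ_φ(I)} = ∫_0^∞ φ(|{x ∈ I : f(x) > t}|/|I|) dt`. -/
def lorentz (φ : ℝ → ℝ) (f : ℝ → ℝ) (I : ℝ × ℝ) : ℝ :=
  ∫ t in Set.Ioi (0 : ℝ), φ ((volume {x | x ∈ ivSet I ∧ t < f x}).toReal / len I)

/-- The fundamental function `φ₀(s) = s(1 - log s)` of `L log L` (note `φ₀(0) = 0`,
as `Real.log 0 = 0`). -/
def phi0 (s : ℝ) : ℝ := s * (1 - Real.log s)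

/-- The `j`-th child in `𝐊_{i+1}` of `K ∈ 𝐊ᵢ`. -/
def child (k : ℕ) (K : ℝ × ℝ) (j : ℕ) : ℝ × ℝ :=
  ((mid K).1 + (j : ℝ) * ((3 : ℝ) ^ (1 - (k : ℤ)) * len (mid K)),
    (mid K).1 + ((j : ℝ) + 1) * ((3 : ℝ) ^ (1 - (k : ℤ)) * len (mid K)))

/-- The union of `𝐊ᵢ`. -/
def UU (k i : ℕ) : Set ℝ := ⋃ K ∈ Kfam k i, ivSet K

/-- The union of the intervals `I(J)`, `J ∈ 𝐉_{i+1}`. -/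
def EE (k : ℕ) (ch : ℝ × ℝ → Bool) (i : ℕ) : Set ℝ := ⋃ K ∈ Kfam k i, ivSet (IJ k ch (mid K))

/-- The number `3^{k-1}`. -/
def NN (k : ℕ) : ℝ := (3 : ℝ) ^ (k - 1)

lemma NN_ge (k : ℕ) : 1 ≤ NN k := one_le_pow₀ (by norm_num)

lemma NN_pos (k : ℕ) : 0 < NN k := lt_of_lt_of_le one_pos (NN_ge k)

lemma zpow_eq (k : ℕ) (hk : 1 ≤ k) : (3 : ℝ) ^ (1 - (k : ℤ)) = 1 / NN k := by
  have : (1 - (k : ℤ)) = -((k - 1 : ℕ) : ℤ) := by omega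
  rw [this, zpow_neg, zpow_natCast, NN, one_div]

lemma pow_eq (k : ℕ) (hk : 1 ≤ k) : (3 : ℝ) ^ k = 3 * NN k := by
  obtain ⟨m, rfl⟩ : ∃ m, k = m + 1 := ⟨k - 1, by omega⟩
  simp [NN, pow_succ, mul_comm]

lemma mem_Kfam_succ (k i : ℕ) (I : ℝ × ℝ) :
    I ∈ Kfam k (i + 1) ↔ ∃ K ∈ Kfam k i, ∃ j : ℕ, j < 3 ^ (k - 1) ∧ I = child k K j := Iff.rfl

lemma len_mid (K : ℝ × ℝ) : len (mid K) = len K / 3 := by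
  simp only [len, mid]; ring

lemma child_eq (k : ℕ) (hk : 1 ≤ k) (K : ℝ × ℝ) (j : ℕ) :
    child k K j = (K.1 + len K / 3 + j * (len K / (3 * NN k)),
      K.1 + len K / 3 + (j + 1) * (len K / (3 * NN k))) := by
  have := NN_pos k
  rw [child, zpow_eq k hk, len_mid]
  simp only [mid, len]
  ext <;> simp only <;> field_simp

lemma len_child (k : ℕ) (hk : 1 ≤ k) (K : ℝ × ℝ) (j : ℕ) :
    len (child k K j) = len K / (3 * NN k) := by
  rw [child_eq k hk]; simp only [len]; ring

lemma Kfam_len_pos (k : ℕ) (hk : 1 ≤ k) (i : ℕ) : ∀ K ∈ Kfam k i, 0 < len K := by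
  induction i with
  | zero => intro K hK; simp only [Kfam, mem_singleton_iff] at hK; subst hK; simp [len]
  | succ i ih =>
    intro K hK
    obtain ⟨P, hP, j, -, rfl⟩ := (mem_Kfam_succ k i K).1 hK
    rw [len_child k hk]
    have := ih P hP
    have := NN_pos k
    positivity

lemma child_sub_mid (k : ℕ) (hk : 1 ≤ k) (K : ℝ × ℝ) (hK : 0 < len K) (j : ℕ)
    (hj : j < 3 ^ (k - 1)) : ivSet (child k K j) ⊆ ivSet (mid K) := by
  have hN := NN_pos k
  rw [child_eq k hk]
  have hj' : (j : ℝ) + 1 ≤ NN k := by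
    rw [NN]; exact_mod_cast hj
  apply Ico_subset_Ico
  · simp only [mid, len] at *
    have : 0 ≤ (j : ℝ) * ((K.2 - K.1) / (3 * NN k)) := by positivity
    linarith
  · simp only [mid]
    have h1 : ((j : ℝ) + 1) * (len K / (3 * NN k)) ≤ NN k * (len K / (3 * NN k)) := by gcongr
    have h2 : NN k * (len K / (3 * NN k)) = len K / 3 := by field_simp
    simp only [len] at *
    linarith

lemma mid_sub (K : ℝ × ℝ) (hK : 0 < len K) : ivSet (mid K) ⊆ ivSet K := by
  simp only [len] at hK
  apply Ico_subset_Ico <;> simp only [mid] <;> linarith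

lemma IJ_sub (k : ℕ) (hk : 1 ≤ k) (ch : ℝ × ℝ → Bool) (K : ℝ × ℝ) (hK : 0 < len K) :
    ivSet (IJ k ch (mid K)) ⊆ ivSet K := by
  have hN := NN_ge k
  have h : 1 / NN k * (len K / 3) ≤ len K / 3 := by
    have : 1 / NN k ≤ 1 := by rw [div_le_one (NN_pos k)]; exact hN
    exact mul_le_of_le_one_left (by positivity) this
  have h0 : 0 ≤ 1 / NN k * (len K / 3) := by have := NN_pos k; positivity
  rw [IJ, zpow_eq k hk, len_mid]
  simp only [len] at *
  split_ifs <;> apply Ico_subset_Ico <;> simp only [mid] <;> linarith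

lemma IJ_disj (k : ℕ) (ch : ℝ × ℝ → Bool) (K : ℝ × ℝ) :
    Disjoint (ivSet (IJ k ch (mid K))) (ivSet (mid K)) := by
  rw [Set.disjoint_left]
  intro x hx hx'
  rw [IJ] at hx
  simp only [ivSet, mem_Ico] at hx'
  split_ifs at hx <;> simp only [ivSet, mem_Ico] at hx <;> linarith

lemma len_IJ (k : ℕ) (hk : 1 ≤ k) (ch : ℝ × ℝ → Bool) (K : ℝ × ℝ) :
    len (IJ k ch (mid K)) = len K / (3 * NN k) := by
  have := NN_pos k
  rw [IJ, zpow_eq k hk, len_mid]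
  split_ifs <;> simp only [len] <;> field_simp <;> ring

lemma child_disj (k : ℕ) (hk : 1 ≤ k) (K : ℝ × ℝ) (hK : 0 < len K) (j j' : ℕ) (x : ℝ)
    (h : x ∈ ivSet (child k K j)) (h' : x ∈ ivSet (child k K j')) : j = j' := by
  have hN := NN_pos k
  rw [child_eq k hk] at h h'
  have hd : 0 < len K / (3 * NN k) := by positivity
  set d := len K / (3 * NN k)
  simp only [ivSet, mem_Ico] at h h'
  have h1 : (j : ℝ) < j' + 1 := lt_of_mul_lt_mul_right (by linarith) hd.le
  have h2 : (j' : ℝ) < j + 1 := lt_of_mul_lt_mul_right (by linarith) hd.le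
  have h1' : j < j' + 1 := by exact_mod_cast h1
  have h2' : j' < j + 1 := by exact_mod_cast h2
  omega

lemma Kfam_disj (k : ℕ) (hk : 1 ≤ k) (i : ℕ) : ∀ K ∈ Kfam k i, ∀ K' ∈ Kfam k i, ∀ x,
    x ∈ ivSet K → x ∈ ivSet K' → K = K' := by
  induction i with
  | zero => intro K hK K' hK'; simp only [Kfam, mem_singleton_iff] at hK hK'; simp [hK, hK']
  | succ i ih =>
    intro K hK K' hK' x hx hx'
    obtain ⟨P, hP, j, hj, rfl⟩ := (mem_Kfam_succ k i K).1 hK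
    obtain ⟨P', hP', j', hj', rfl⟩ := (mem_Kfam_succ k i K').1 hK'
    have p := Kfam_len_pos k hk i P hP
    have p' := Kfam_len_pos k hk i P' hP'
    have := ih P hP P' hP' x (mid_sub P p (child_sub_mid k hk P p j hj hx))
      (mid_sub P' p' (child_sub_mid k hk P' p' j' hj' hx'))
    subst this
    rw [child_disj k hk P p j j' x hx hx']

lemma Kfam_countable (k i : ℕ) : (Kfam k i).Countable := by
  induction i with
  | zero => exact countable_singleton _
  | succ i ih =>
    have : Kfam k (i + 1) ⊆ ⋃ K ∈ Kfam k i, range (child k K) := by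
      intro I hI
      obtain ⟨P, hP, j, hj, rfl⟩ := (mem_Kfam_succ k i I).1 hI
      exact mem_biUnion hP ⟨j, rfl⟩
    exact (ih.biUnion fun K _ => countable_range _).mono this

lemma meas_iv (I : ℝ × ℝ) : MeasurableSet (ivSet I) := measurableSet_Ico

lemma meas_EE (k : ℕ) (ch : ℝ × ℝ → Bool) (i : ℕ) : MeasurableSet (EE k ch i) :=
  MeasurableSet.biUnion (Kfam_countable k i) fun _ _ => meas_iv _

lemma meas_UU (k : ℕ) (i : ℕ) : MeasurableSet (UU k i) :=
  MeasurableSet.biUnion (Kfam_countable k i) fun _ _ => meas_iv _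

lemma EE_sub (k : ℕ) (hk : 1 ≤ k) (ch : ℝ × ℝ → Bool) (i : ℕ) : EE k ch i ⊆ UU k i := by
  intro x hx
  simp only [EE, mem_iUnion] at hx
  obtain ⟨K, hK, hx⟩ := hx
  exact mem_biUnion hK (IJ_sub k hk ch K (Kfam_len_pos k hk i K hK) hx)

lemma UU_succ (k : ℕ) (hk : 1 ≤ k) (i : ℕ) (x : ℝ) (hx : x ∈ UU k (i + 1)) :
    ∃ K ∈ Kfam k i, x ∈ ivSet (mid K) ∧ ∃ j < 3 ^ (k - 1), x ∈ ivSet (child k K j) := by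
  simp only [UU, mem_iUnion] at hx
  obtain ⟨K, hK, hx⟩ := hx
  obtain ⟨P, hP, j, hj, rfl⟩ := (mem_Kfam_succ k i K).1 hK
  exact ⟨P, hP, child_sub_mid k hk P (Kfam_len_pos k hk i P hP) j hj hx, j, hj, hx⟩

lemma UU_anti (k : ℕ) (hk : 1 ≤ k) : Antitone (UU k) := by
  refine antitone_nat_of_succ_le fun i x hx => ?_
  obtain ⟨K, hK, hx, -⟩ := UU_succ k hk i x hx
  exact mem_biUnion hK (mid_sub K (Kfam_len_pos k hk i K hK) hx)

lemma EE_UU_disj (k : ℕ) (hk : 1 ≤ k) (ch : ℝ × ℝ → Bool) (i : ℕ) (x : ℝ)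
    (h : x ∈ EE k ch i) (h' : x ∈ UU k (i + 1)) : False := by
  obtain ⟨K, hK, hx, -⟩ := UU_succ k hk i x h'
  simp only [EE, mem_iUnion] at h
  obtain ⟨K', hK', hx'⟩ := h
  have := Kfam_disj k hk i K hK K' hK' x (mid_sub K (Kfam_len_pos k hk i K hK) hx)
    (IJ_sub k hk ch K' (Kfam_len_pos k hk i K' hK') hx')
  subst this
  exact Set.disjoint_left.1 (IJ_disj k ch K) hx' hx

lemma EE_disj (k : ℕ) (hk : 1 ≤ k) (ch : ℝ × ℝ → Bool) (i i' : ℕ) (x : ℝ)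
    (h : x ∈ EE k ch i) (h' : x ∈ EE k ch i') : i = i' := by
  rcases lt_trichotomy i i' with hl | hl | hl
  · exact (EE_UU_disj k hk ch i x h (UU_anti k hk hl (EE_sub k hk ch i' h'))).elim
  · exact hl
  · exact (EE_UU_disj k hk ch i' x h' (UU_anti k hk hl (EE_sub k hk ch i h))).elim

/-- Self-similar measure computation. -/
lemma vol_self (k : ℕ) (hk : 1 ≤ k) (F : ℕ → Set ℝ) (hF : ∀ n, F n ⊆ UU k n)
    (hm : ∀ n, MeasurableSet (F n)) (c : ℝ)
    (hc : ∀ n, ∀ K ∈ Kfam k n, volume.real (F n ∩ ivSet K) = c * len K) (m : ℕ) :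
    ∀ i, ∀ K ∈ Kfam k i, volume.real (F (i + m) ∩ ivSet K) = c * (1 / 3) ^ m * len K := by
  have hN := NN_pos k
  induction m with
  | zero => intro i K hK; simp [hc i K hK]
  | succ m ih =>
    intro i K hK
    have hl := Kfam_len_pos k hk i K hK
    have hset : F (i + (m + 1)) ∩ ivSet K =
        ⋃ j ∈ Finset.range (3 ^ (k - 1)), (F (i + 1 + m) ∩ ivSet (child k K j)) := by
      have e : i + (m + 1) = i + 1 + m := by ring
      rw [e]
      ext x
      simp only [mem_inter_iff, mem_iUnion, Finset.mem_range, exists_prop]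
      constructor
      · rintro ⟨h1, h2⟩
        obtain ⟨P, hP, hx, j, hj, hxj⟩ :=
          UU_succ k hk i x (UU_anti k hk (Nat.le_add_right (i + 1) m) (hF _ h1))
        have := Kfam_disj k hk i P hP K hK x (mid_sub P (Kfam_len_pos k hk i P hP) hx) h2
        subst this
        exact ⟨j, hj, h1, hxj⟩
      · rintro ⟨j, hj, h1, h2⟩
        exact ⟨h1, mid_sub K hl (child_sub_mid k hk K hl j hj h2)⟩
    have hfin : ∀ j ∈ Finset.range (3 ^ (k - 1)),
        volume (F (i + 1 + m) ∩ ivSet (child k K j)) ≠ ⊤ := fun j _ =>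
      ne_top_of_le_ne_top (by simp [ivSet]) (measure_mono inter_subset_right)
    rw [hset, measureReal_biUnion_finset (h := hfin)]
    · rw [Finset.sum_congr rfl (g := fun _ => c * (1 / 3) ^ m * (len K / (3 * NN k)))]
      · rw [Finset.sum_const, Finset.card_range, nsmul_eq_mul]
        have : ((3 ^ (k - 1) : ℕ) : ℝ) = NN k := by simp [NN]
        rw [this, pow_succ]
        field_simp
      · intro j hj
        rw [ih (i + 1) (child k K j) ⟨K, hK, j, Finset.mem_range.1 hj, rfl⟩, len_child k hk]
    · intro j _ j' _ hne
      rw [Function.onFun, Set.disjoint_left]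
      intro x hx hx'
      exact hne (child_disj k hk K hl j j' x hx.2 hx'.2)
    · intro j _
      exact (hm _).inter (meas_iv _)

lemma vol_iv (I : ℝ × ℝ) (h : 0 ≤ len I) : volume.real (ivSet I) = len I := by
  rw [ivSet, Measure.real, Real.volume_Ico]
  exact ENNReal.toReal_ofReal h

lemma EE_inter (k : ℕ) (hk : 1 ≤ k) (ch : ℝ × ℝ → Bool) (n : ℕ) (K : ℝ × ℝ) (hK : K ∈ Kfam k n) :
    EE k ch n ∩ ivSet K = ivSet (IJ k ch (mid K)) := by
  have hl := Kfam_len_pos k hk n K hK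
  ext x
  constructor
  · rintro ⟨h1, h2⟩
    simp only [EE, mem_iUnion] at h1
    obtain ⟨P, hP, hx⟩ := h1
    have := Kfam_disj k hk n P hP K hK x (IJ_sub k hk ch P (Kfam_len_pos k hk n P hP) hx) h2
    subst this
    exact hx
  · intro h
    exact ⟨mem_biUnion hK h, IJ_sub k hk ch K hl h⟩

lemma vol_EE (k : ℕ) (hk : 1 ≤ k) (ch : ℝ × ℝ → Bool) (m i : ℕ) (K : ℝ × ℝ) (hK : K ∈ Kfam k i) :
    volume.real (EE k ch (i + m) ∩ ivSet K) = (1 / (3 * NN k)) * (1 / 3) ^ m * len K := by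
  refine vol_self k hk (EE k ch) (EE_sub k hk ch) (meas_EE k ch) _ ?_ m i K hK
  intro n K hK
  have hl := Kfam_len_pos k hk n K hK
  have hN := NN_pos k
  rw [EE_inter k hk ch n K hK, vol_iv, len_IJ k hk]
  · ring
  · rw [len_IJ k hk]; positivity

lemma vol_UU (k : ℕ) (hk : 1 ≤ k) (m i : ℕ) (K : ℝ × ℝ) (hK : K ∈ Kfam k i) :
    volume.real (UU k (i + m) ∩ ivSet K) = (1 / 3) ^ m * len K := by
  have := vol_self k hk (UU k) (fun _ => le_rfl) (meas_UU k) 1 ?_ m i K hK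
  · simpa using this
  intro n K hK
  rw [inter_eq_self_of_subset_right, vol_iv, one_mul]
  · exact (Kfam_len_pos k hk n K hK).le
  · exact fun x hx => mem_biUnion hK hx

/-- The base `ρ = 3^k/(3^{k-1}+1)`. -/
def rho (k : ℕ) : ℝ := (3 : ℝ) ^ k / ((3 : ℝ) ^ (k - 1) + 1)

lemma rho_eq (k : ℕ) (hk : 1 ≤ k) : rho k = 3 * (NN k / (NN k + 1)) := by
  rw [rho, pow_eq k hk, ← NN]; ring

lemma mid_inj (K K' : ℝ × ℝ) (h : mid K = mid K') : K = K' := by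
  simp only [mid, Prod.mk.injEq] at h
  ext <;> linarith [h.1, h.2]

lemma inner_eq (k : ℕ) (hk : 1 ≤ k) (ch : ℝ × ℝ → Bool) (i : ℕ) (a x : ℝ) :
    (∑' J : ↥(Jfam k (i + 1)), Set.indicator (ivSet (IJ k ch (J : ℝ × ℝ))) (fun _ => a) x) =
      (EE k ch i).indicator (fun _ => a) x := by
  by_cases hx : x ∈ EE k ch i
  · rw [indicator_of_mem hx]
    simp only [EE, mem_iUnion] at hx
    obtain ⟨K, hK, hx⟩ := hx
    rw [tsum_eq_single (⟨mid K, K, hK, rfl⟩ : ↥(Jfam k (i + 1)))]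
    · rw [indicator_of_mem hx]
    · rintro ⟨J, P, hP, rfl⟩ hne
      rw [indicator_of_notMem]
      intro hx'
      apply hne
      have hP' : P ∈ Kfam k i := hP
      have := Kfam_disj k hk i P hP' K hK x (IJ_sub k hk ch P (Kfam_len_pos k hk i P hP) hx')
        (IJ_sub k hk ch K (Kfam_len_pos k hk i K hK) hx)
      subst this
      rfl
  · rw [indicator_of_notMem hx]
    have : ∀ J : ↥(Jfam k (i + 1)),
        Set.indicator (ivSet (IJ k ch (J : ℝ × ℝ))) (fun _ => a) x = 0 := by
      rintro ⟨J, P, hP, rfl⟩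
      rw [indicator_of_notMem]
      intro hx'
      exact hx (mem_biUnion hP hx')
    simp [this]

lemma step_mem (k : ℕ) (hk : 1 ≤ k) (ch : ℝ × ℝ → Bool) (a : ℕ → ℝ) (i : ℕ) (x : ℝ)
    (hx : x ∈ EE k ch i) : ∑' i, (EE k ch i).indicator (fun _ => a i) x = a i := by
  rw [tsum_eq_single i]
  · rw [indicator_of_mem hx]
  · intro i' hne
    rw [indicator_of_notMem]
    intro hx'
    exact hne (EE_disj k hk ch i' i x hx' hx)

lemma step_nmem (k : ℕ) (ch : ℝ × ℝ → Bool) (a : ℕ → ℝ) (x : ℝ)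
    (hx : ∀ i, x ∉ EE k ch i) : ∑' i, (EE k ch i).indicator (fun _ => a i) x = 0 := by
  simp [hx]

lemma wgt_eq (k : ℕ) (hk : 1 ≤ k) (ch : ℝ × ℝ → Bool) (x : ℝ) :
    wgt k ch x = ∑' i, (EE k ch i).indicator (fun _ => rho k ^ (i + 1)) x := by
  rw [wgt]
  exact tsum_congr fun i => inner_eq k hk ch i _ x

lemma rho_pos (k : ℕ) (hk : 1 ≤ k) : 0 < rho k := by
  have := NN_pos k
  rw [rho_eq k hk]; positivity

lemma sgm2_eq (k : ℕ) (hk : 1 ≤ k) (ch : ℝ × ℝ → Bool) (x : ℝ) :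
    sgm2 k ch x = ∑' i, (EE k ch i).indicator (fun _ => ((rho k) ^ (i + 1))⁻¹) x := by
  have := rho_pos k hk
  rw [sgm2, wgt_eq k hk]
  by_cases h : ∃ i, x ∈ EE k ch i
  · obtain ⟨i, hi⟩ := h
    rw [step_mem k hk ch _ i x hi, step_mem k hk ch _ i x hi, if_pos (by positivity)]
  · push Not at h
    rw [step_nmem k ch _ x h, step_nmem k ch _ x h, if_neg (lt_irrefl _)]

lemma step_mass (k : ℕ) (ch : ℝ × ℝ → Bool) (a : ℕ → ℝ) (ha : ∀ i, 0 ≤ a i)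
    (R : ℝ × ℝ) (hs : Summable fun i => a i * volume.real (EE k ch i ∩ ivSet R)) :
    mass (fun x => ∑' i, (EE k ch i).indicator (fun _ => a i) x) R =
      ∑' i, a i * volume.real (EE k ch i ∩ ivSet R) := by
  have hint : ∀ i, ∫ x in ivSet R, (EE k ch i).indicator (fun _ => a i) x =
      a i * volume.real (EE k ch i ∩ ivSet R) := by
    intro i
    rw [integral_indicator_const _ (meas_EE k ch i), smul_eq_mul, mul_comm,
      measureReal_restrict_apply (meas_EE k ch i)]
  have hf : volume (ivSet R) ≠ ⊤ := by simp [ivSet]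
  have := hasSum_integral_of_summable_integral_norm (μ := volume.restrict (ivSet R))
    (F := fun i => (EE k ch i).indicator (fun _ => a i)) ?_ ?_
  · rw [mass, ← this.tsum_eq]
    exact tsum_congr hint
  · intro i
    have : IsFiniteMeasure (volume.restrict (ivSet R)) := ⟨by simpa using hf.lt_top⟩
    exact (integrable_const (a i)).indicator (meas_EE k ch i)
  · refine hs.congr fun i => ?_
    rw [← hint i]
    refine integral_congr_ae (Eventually.of_forall fun x => ?_)
    simp only [Real.norm_eq_abs]
    rw [abs_of_nonneg]
    exact indicator_nonneg (fun _ _ => ha i) x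

lemma exists_R (k : ℕ) (hk : 1 ≤ k) (ch : ℝ × ℝ → Bool) :
    ∃ R K : ℝ × ℝ, 0 ≤ R.1 ∧ R.1 < R.2 ∧ R.2 ≤ 1 ∧ K ∈ Kfam k 1 ∧
      len R = 2 / (3 * NN k) ∧ len K = 1 / (3 * NN k) ∧ ivSet R = EE k ch 0 ∪ ivSet K := by
  have hN := NN_pos k
  have hroot : ((0 : ℝ), (1 : ℝ)) ∈ Kfam k 0 := rfl
  have hE : EE k ch 0 = ivSet (IJ k ch (mid (0, 1))) := by
    simp [EE, Kfam]
  have hd : 0 < 1 / (3 * NN k) := by positivity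
  have hd1 : 1 / (3 * NN k) ≤ 1 / 3 := by
    have := NN_ge k
    gcongr; linarith
  have hK : ∀ j < 3 ^ (k - 1), child k (0, 1) j ∈ Kfam k 1 := fun j hj => ⟨_, hroot, j, hj, rfl⟩
  have hIJ := len_mid ((0 : ℝ), (1 : ℝ))
  have hNd : NN k * (1 / (3 * NN k)) = 1 / 3 := by field_simp
  have h2d : 2 / (3 * NN k) = 2 * (1 / (3 * NN k)) := by ring
  have h3d : 1 / NN k * (1 / 3) = 1 / (3 * NN k) := by field_simp
  rw [hE, IJ, hIJ, zpow_eq k hk, h2d]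
  have hlen : len ((0 : ℝ), (1 : ℝ)) = 1 := by simp [len]
  rw [hlen, h3d]
  have hmid : mid ((0 : ℝ), (1 : ℝ)) = (1 / 3, 2 / 3) := by simp [mid]; norm_num
  rw [hmid]
  split_ifs with hc
  · have hp : 0 < 3 ^ (k - 1) := by positivity
    have hcast : ((3 ^ (k - 1) - 1 : ℕ) : ℝ) = NN k - 1 := by
      rw [Nat.cast_sub hp]; simp [NN]
    have hce := child_eq k hk (0, 1) (3 ^ (k - 1) - 1)
    rw [hlen, hcast] at hce
    refine ⟨(2 / 3 - 1 / (3 * NN k), 2 / 3 + 1 / (3 * NN k)), _, ?_, ?_, ?_,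
      hK (3 ^ (k - 1) - 1) (by omega), ?_, ?_, ?_⟩
    · simp only; linarith
    · simp only; linarith
    · simp only; linarith
    · simp only [len]; ring
    · rw [len_child k hk, hlen]
    · have hce' : child k (0, 1) (3 ^ (k - 1) - 1) = (2 / 3 - 1 / (3 * NN k), 2 / 3) := by
        rw [hce]; ext <;> simp only <;> linarith
      rw [hce', union_comm]
      simp only [ivSet]
      rw [Ico_union_Ico_eq_Ico] <;> linarith
  · have hce := child_eq k hk (0, 1) 0
    rw [hlen] at hce
    refine ⟨(1 / 3 - 1 / (3 * NN k), 1 / 3 + 1 / (3 * NN k)), _, ?_, ?_, ?_,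
      hK 0 (by positivity), ?_, ?_, ?_⟩
    · simp only; linarith
    · simp only; linarith
    · simp only; linarith
    · simp only [len]; ring
    · rw [len_child k hk, hlen]
    · have hce' : child k (0, 1) 0 = (1 / 3, 1 / 3 + 1 / (3 * NN k)) := by
        rw [hce]; ext <;> simp
      rw [hce']
      simp only [ivSet]
      rw [Ico_union_Ico_eq_Ico] <;> linarith

lemma phi0_mono (a b : ℝ) (ha : 0 < a) (hab : a ≤ b) (hb : b ≤ 1) : phi0 a ≤ phi0 b := by
  have hb0 : 0 < b := ha.trans_le hab
  have h1 : Real.log (b / a) ≤ b / a - 1 := Real.log_le_sub_one_of_pos (by positivity)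
  rw [Real.log_div hb0.ne' ha.ne'] at h1
  have h2 : a * (Real.log b - Real.log a) ≤ b - a := by
    calc _ ≤ a * (b / a - 1) := by gcongr
      _ = b - a := by field_simp
  have h3 : Real.log b ≤ 0 := Real.log_nonpos hb0.le hb
  simp only [phi0]
  nlinarith

lemma phi0_nonneg (s : ℝ) (h0 : 0 ≤ s) (h1 : s ≤ 1) : 0 ≤ phi0 s := by
  have := Real.log_nonpos h0 h1
  exact mul_nonneg h0 (by linarith)

lemma phi0_le_one (s : ℝ) (h0 : 0 ≤ s) (h1 : s ≤ 1) : phi0 s ≤ 1 := by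
  rcases h0.eq_or_lt with rfl | h
  · simp [phi0]
  · have := phi0_mono s 1 h h1 le_rfl
    simpa [phi0] using this

lemma phi0_le_rpow (s δ : ℝ) (h0 : 0 ≤ s) (h1 : s ≤ 1) (hδ : 0 < δ) :
    phi0 s ≤ (1 + 1 / δ) * s ^ (1 - δ) := by
  rcases h0.eq_or_lt with rfl | h
  · simp only [phi0, zero_mul]; positivity
  · have e : s ^ (1 - δ) = s * (s⁻¹) ^ δ := by
      rw [Real.rpow_sub h, Real.rpow_one, Real.inv_rpow h.le, div_eq_mul_inv]
    have h2 := Real.log_le_rpow_div (inv_nonneg.2 h0) hδ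
    rw [Real.log_inv] at h2
    have h3 : 1 ≤ (s⁻¹) ^ δ := Real.one_le_rpow ((one_le_inv₀ h).2 h1) hδ.le
    rw [e, phi0]
    calc s * (1 - Real.log s) ≤ s * ((s⁻¹) ^ δ + (s⁻¹) ^ δ / δ) := by gcongr; linarith
      _ = _ := by ring

lemma phi0_meas : Measurable phi0 := by
  unfold phi0; fun_prop

lemma analytic_int (ρ : ℝ) (h1 : 1 < ρ) (h3 : ρ < 3) (D : ℝ → ℝ) (hD : Antitone D)
    (hD0 : ∀ t, 0 ≤ D t) (hD1 : ∀ t, D t ≤ 1)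
    (hup : ∀ n : ℕ, ∀ t, ρ ^ (n + 1) ≤ t → D t ≤ (1 / 3) ^ n / 2) :
    IntegrableOn (fun t => phi0 (D t)) (Ioi 0) := by
  have hρ0 : 0 < ρ := by linarith
  have hm : Measurable fun t => phi0 (D t) := phi0_meas.comp hD.measurable
  have hlog : 0 < Real.log ρ := Real.log_pos h1
  obtain ⟨q, hq⟩ : ∃ q, q = Real.log 3 / Real.log ρ := ⟨_, rfl⟩
  have hq1 : 1 < q := by
    rw [hq, one_lt_div hlog]; exact Real.log_lt_log hρ0 h3
  have hρq : ρ ^ q = 3 := by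
    rw [Real.rpow_def_of_pos hρ0, hq, mul_div_cancel₀ _ hlog.ne', Real.exp_log (by norm_num)]
  obtain ⟨δ, hδ⟩ : ∃ δ, δ = (q - 1) / (2 * q) := ⟨_, rfl⟩
  have hδ0 : 0 < δ := by rw [hδ]; apply div_pos <;> linarith
  have hδ1 : δ < 1 := by rw [hδ, div_lt_one (by linarith)]; linarith
  have hqδ : q * (1 - δ) = (q + 1) / 2 := by
    rw [hδ]; field_simp; ring
  have hsplit : Ioi (0 : ℝ) = Ioc 0 ρ ∪ Ioi ρ := (Ioc_union_Ioi_eq_Ioi hρ0.le).symm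
  rw [hsplit]
  refine IntegrableOn.union ?_ ?_
  · refine Measure.integrableOn_of_bounded (M := 1) (by simp) hm.aestronglyMeasurable ?_
    refine Eventually.of_forall fun t => ?_
    rw [Real.norm_eq_abs, abs_of_nonneg (phi0_nonneg _ (hD0 t) (hD1 t))]
    exact phi0_le_one _ (hD0 t) (hD1 t)
  · have hg : IntegrableOn
        (fun t : ℝ => (1 + 1 / δ) * (9 / 2 : ℝ) ^ (1 - δ) * t ^ (-((q + 1) / 2))) (Ioi ρ) :=
      (integrableOn_Ioi_rpow_of_lt (by linarith) hρ0).const_mul _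
    refine Integrable.mono' hg hm.aestronglyMeasurable ?_
    refine (ae_restrict_iff' measurableSet_Ioi).2 (Eventually.of_forall fun t ht => ?_)
    rw [Real.norm_eq_abs, abs_of_nonneg (phi0_nonneg _ (hD0 t) (hD1 t))]
    have ht' : ρ < t := ht
    have ht0 : 0 < t := by linarith
    obtain ⟨n, hn1, hn2⟩ := exists_nat_pow_near (x := t / ρ) (y := ρ)
      ((one_le_div hρ0).2 ht'.le) h1
    have hn1' : ρ ^ (n + 1) ≤ t := by rw [le_div_iff₀ hρ0] at hn1; rwa [pow_succ]
    have hn2' : t ≤ ρ ^ (n + 2) := by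
      rw [div_lt_iff₀ hρ0] at hn2; rw [pow_succ]; exact hn2.le
    have hDt : D t ≤ 9 / 2 * t ^ (-q) := by
      calc D t ≤ (1 / 3) ^ n / 2 := hup n t hn1'
        _ = 9 / 2 * (ρ ^ (n + 2)) ^ (-q) := by
          rw [Real.rpow_neg (by positivity), ← Real.rpow_natCast ρ, ← Real.rpow_mul hρ0.le,
            mul_comm _ q, Real.rpow_mul hρ0.le, hρq, Real.rpow_natCast, pow_add, one_div, inv_pow,
            mul_inv]
          norm_num; ring
        _ ≤ 9 / 2 * t ^ (-q) := by
          have := Real.rpow_le_rpow_of_nonpos ht0 hn2' (by linarith : -q ≤ 0)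
          linarith
    calc phi0 (D t) ≤ (1 + 1 / δ) * D t ^ (1 - δ) := phi0_le_rpow _ δ (hD0 t) (hD1 t) hδ0
      _ ≤ (1 + 1 / δ) * (9 / 2 * t ^ (-q)) ^ (1 - δ) := by
        have := Real.rpow_le_rpow (hD0 t) hDt (by linarith : 0 ≤ 1 - δ)
        gcongr
      _ = _ := by
        rw [Real.mul_rpow (by norm_num) (by positivity), ← Real.rpow_mul ht0.le, neg_mul, hqδ]
        ring

lemma r_pow (N : ℝ) (m : ℕ) (hN : (m : ℝ) = N) (hN0 : 0 < N) (n : ℕ) (hn : n ≤ m) :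
    1 / 3 ≤ (N / (N + 1)) ^ n := by
  have h1 : (N / (N + 1)) ^ m ≤ (N / (N + 1)) ^ n :=
    pow_le_pow_of_le_one (by positivity) (by rw [div_le_one (by positivity)]; linarith) hn
  refine le_trans ?_ h1
  have h2 : (N + 1) / N ≤ Real.exp (1 / N) := by
    have := Real.add_one_le_exp (1 / N)
    calc (N + 1) / N = 1 / N + 1 := by field_simp; ring
      _ ≤ _ := this
  have h3 : ((N + 1) / N) ^ m ≤ 3 := by
    calc ((N + 1) / N) ^ m ≤ Real.exp (1 / N) ^ m := by gcongr
      _ = Real.exp 1 := by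
        rw [← Real.exp_nat_mul, hN]; congr 1; field_simp
      _ ≤ 3 := Real.exp_one_lt_three.le
  have e : (N / (N + 1)) ^ m = 1 / ((N + 1) / N) ^ m := by
    rw [← one_div_pow, one_div_div]
  rw [e]
  exact one_div_le_one_div_of_le (by positivity) h3

lemma analytic_low (N : ℝ) (m : ℕ) (hmN : (m : ℝ) = N) (hN : 2 ≤ N) (ρ : ℝ)
    (hρ : ρ = 3 * (N / (N + 1))) (D : ℝ → ℝ)
    (hD0 : ∀ t, 0 ≤ D t) (hD1 : ∀ t, D t ≤ 1)
    (hint : IntegrableOn (fun t => phi0 (D t)) (Ioi 0))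
    (hlow : ∀ n : ℕ, ∀ t, t < ρ ^ (n + 1) → (1 / 3) ^ n / (2 * N) ≤ D t) :
    N / 48 ≤ ∫ t in Ioi (0 : ℝ), phi0 (D t) := by
  have hN0 : 0 < N := by linarith
  have hρ2 : 2 ≤ ρ := by
    rw [hρ, mul_div_assoc', le_div_iff₀ (by linarith)]; linarith
  have hρ0 : 0 < ρ := by linarith
  have hlog : 1 / 2 ≤ Real.log ρ := by
    have := Real.log_le_log (by norm_num) hρ2
    have := Real.log_two_gt_d9
    linarith
  have hT : 1 ≤ ρ ^ m := one_le_pow₀ (by linarith)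
  have hpt : ∀ t ∈ Ico 1 (ρ ^ m), Real.log t / t * (1 / (6 * N)) ≤ phi0 (D t) := by
    rintro t ⟨ht1, ht2⟩
    have ht0 : 0 < t := by linarith
    obtain ⟨n, hn1, hn2⟩ := exists_nat_pow_near (x := t) (y := ρ) ht1 (by linarith)
    have hnm : n < m := by
      have : ρ ^ n < ρ ^ m := hn1.trans_lt ht2
      exact (pow_lt_pow_iff_right₀ (by linarith)).1 this
    have hd : 1 / (6 * N * t) ≤ D t := by
      refine le_trans ?_ (hlow n t hn2)
      have hr := r_pow N m hmN hN0 n hnm.le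
      have e : ρ ^ n = 3 ^ n * (N / (N + 1)) ^ n := by rw [hρ, mul_pow]
      have : (3 : ℝ) ^ n / 3 ≤ t := by
        have : (3 : ℝ) ^ n * (1 / 3) ≤ 3 ^ n * (N / (N + 1)) ^ n := by gcongr
        linarith
      rw [one_div_pow, div_div]
      apply one_div_le_one_div_of_le (by positivity)
      nlinarith
    have hpos : 0 < 1 / (6 * N * t) := by positivity
    refine le_trans ?_ (phi0_mono _ _ hpos hd (hD1 t))
    have hl : Real.log t ≤ Real.log (6 * N * t) := Real.log_le_log ht0 (by nlinarith)
    rw [phi0, one_div (6 * N * t), Real.log_inv]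
    calc Real.log t / t * (1 / (6 * N)) = (6 * N * t)⁻¹ * Real.log t := by field_simp
      _ ≤ _ := by gcongr; linarith
  have hder : ∀ t ∈ uIcc 1 (ρ ^ m),
      HasDerivAt (fun t => Real.log t ^ 2 / 2 * (1 / (6 * N)))
        (Real.log t / t * (1 / (6 * N))) t := by
    intro t ht
    rw [uIcc_of_le hT] at ht
    have ht0 : t ≠ 0 := by have := ht.1; linarith
    have := (((Real.hasDerivAt_log ht0).pow 2).div_const 2).mul_const (1 / (6 * N))
    refine this.congr_deriv ?_
    push_cast
    field_simp
  have hcont : ContinuousOn (fun t => Real.log t / t * (1 / (6 * N))) (uIcc 1 (ρ ^ m)) := by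
    rw [uIcc_of_le hT]
    have h0 : ∀ t ∈ Icc 1 (ρ ^ m), t ≠ 0 := fun t ht => by have := ht.1; linarith
    exact ((ContinuousOn.log continuousOn_id h0).div continuousOn_id h0).mul continuousOn_const
  have hii := hcont.intervalIntegrable (μ := volume)
  have hval := intervalIntegral.integral_eq_sub_of_hasDerivAt hder hii
  rw [intervalIntegral.integral_of_le hT, ← integral_Ico_eq_integral_Ioc] at hval
  have hii' : IntegrableOn (fun t => Real.log t / t * (1 / (6 * N))) (Ico 1 (ρ ^ m)) := by
    exact (intervalIntegrable_iff_integrableOn_Ico_of_le hT).1 hii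
  have hsub : Ico 1 (ρ ^ m) ⊆ Ioi (0 : ℝ) := fun t ht => by
    have := ht.1; exact lt_of_lt_of_le one_pos this
  calc N / 48 ≤ Real.log (ρ ^ m) ^ 2 / 2 * (1 / (6 * N)) := by
        rw [Real.log_pow, hmN, mul_one_div, le_div_iff₀ (by positivity)]
        have : 1 / 4 ≤ Real.log ρ ^ 2 := by nlinarith
        have : N ^ 2 * (1 / 4) ≤ N ^ 2 * Real.log ρ ^ 2 := by gcongr
        nlinarith
    _ = ∫ t in Ico 1 (ρ ^ m), Real.log t / t * (1 / (6 * N)) := by rw [hval]; simp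
    _ ≤ ∫ t in Ico 1 (ρ ^ m), phi0 (D t) :=
        setIntegral_mono_on hii' (hint.mono_set hsub) measurableSet_Ico hpt
    _ ≤ _ := by
        refine setIntegral_mono_set hint ?_ (LE.le.eventuallyLE hsub)
        exact Eventually.of_forall fun t => phi0_nonneg _ (hD0 t) (hD1 t)

theorem statement15 :
    ∃ c : ℝ, 0 < c ∧ ∀ k : ℕ, 4000 < k → ∀ ch : ℝ × ℝ → Bool,
      ∃ R : ℝ × ℝ, 0 ≤ R.1 ∧ R.1 < R.2 ∧ R.2 ≤ 1 ∧
        c * ((3 : ℝ) ^ k * avg (wgt k ch) R) ≤ lorentz phi0 (wgt k ch) R ∧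
        c ≤ avg (wgt k ch) R * avg (sgm2 k ch) R := by
  refine ⟨1 / 1000, by norm_num, fun k hk' ch => ?_⟩
  have hk : 1 ≤ k := by omega
  obtain ⟨R, K, hR0, hR, hR1, hK, hlR, hlK, hset⟩ := exists_R k hk ch
  refine ⟨R, hR0, hR, hR1, ?_⟩
  have hN := NN_pos k
  have hcastN : ((3 ^ (k - 1) : ℕ) : ℝ) = NN k := by simp [NN]
  have hN2 : 2 ≤ NN k := by
    have h : (3 : ℝ) ^ 1 ≤ 3 ^ (k - 1) := pow_le_pow_right₀ (by norm_num) (by omega)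
    rw [NN]; linarith
  have hρ := rho_eq k hk
  have hρ0 := rho_pos k hk
  have hρ3 : rho k < 3 := by
    have : NN k / (NN k + 1) < 1 := by rw [div_lt_one (by linarith)]; linarith
    rw [hρ]; linarith
  have hρ2 : 2 ≤ rho k := by
    rw [hρ, mul_div_assoc', le_div_iff₀ (by linarith)]; linarith
  have hlR0 : 0 < len R := by rw [hlR]; positivity
  have hKU : ivSet K ⊆ UU k 1 := fun x hx => mem_biUnion hK hx
  -- measures
  have hE0 : volume.real (EE k ch 0 ∩ ivSet R) = 1 / (3 * NN k) := by
    have e : EE k ch 0 ∩ ivSet R = EE k ch 0 ∩ ivSet (0, 1) := by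
      rw [EE_inter k hk ch 0 (0, 1) rfl, hset, union_comm, inter_eq_self_of_subset_left]
      · simp [EE, Kfam]
      · exact subset_union_right
    rw [e, vol_EE k hk ch 0 0 (0, 1) rfl]
    simp [len]
  have hsubU : ∀ n, UU k (n + 1) ∩ ivSet R ⊆ UU k (1 + n) ∩ ivSet K := by
    rintro n x ⟨h1, h2⟩
    rw [add_comm n 1] at h1
    refine ⟨h1, ?_⟩
    rw [hset] at h2
    rcases h2 with h2 | h2
    · exact (EE_UU_disj k hk ch 0 x h2 (UU_anti k hk (by omega) h1)).elim
    · exact h2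
  have hEs : ∀ n, volume.real (EE k ch (n + 1) ∩ ivSet R) =
      1 / (3 * NN k) * (1 / 3) ^ n * (1 / (3 * NN k)) := by
    intro n
    have hv := vol_EE k hk ch n 1 K hK
    rw [hlK] at hv
    rw [← hv]
    congr 1
    ext x
    constructor
    · rintro ⟨h1, h2⟩
      exact ⟨by rwa [add_comm], (hsubU n ⟨EE_sub k hk ch _ h1, h2⟩).2⟩
    · rintro ⟨h1, h2⟩
      exact ⟨by rwa [add_comm], by rw [hset]; exact Or.inr h2⟩
  have hfinR : volume (ivSet R) ≠ ⊤ := by simp [ivSet]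
  have hUs : ∀ n, volume.real (UU k (n + 1) ∩ ivSet R) ≤ (1 / 3) ^ n * (1 / (3 * NN k)) := by
    intro n
    rw [← hlK, ← vol_UU k hk n 1 K hK]
    refine measureReal_mono (hsubU n) ?_
    exact ne_top_of_le_ne_top (by simp [ivSet]) (measure_mono inter_subset_right)
  -- mass of w
  have hr1 : rho k / 3 = NN k / (NN k + 1) := by rw [hρ]; ring
  have hr0 : 0 ≤ rho k / 3 := by positivity
  have hr1' : rho k / 3 < 1 := by linarith
  have hw : HasSum (fun i => rho k ^ (i + 1) * volume.real (EE k ch i ∩ ivSet R))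
      (rho k * len R) := by
    rw [← hasSum_nat_add_iff' 1]
    have hg := (hasSum_geometric_of_lt_one hr0 hr1').mul_left (rho k ^ 2 / (3 * NN k) ^ 2)
    have e1 : (fun n => rho k ^ (n + 1 + 1) * volume.real (EE k ch (n + 1) ∩ ivSet R)) =
        fun i => rho k ^ 2 / (3 * NN k) ^ 2 * (rho k / 3) ^ i := by
      funext n
      rw [hEs n, div_pow, div_pow, one_pow]
      field_simp
      ring
    have e2 : rho k * len R - ∑ i ∈ Finset.range 1,
        rho k ^ (i + 1) * volume.real (EE k ch i ∩ ivSet R) =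
        rho k ^ 2 / (3 * NN k) ^ 2 * (1 - rho k / 3)⁻¹ := by
      have e3 : 1 - rho k / 3 = 1 / (NN k + 1) := by rw [hr1]; field_simp; ring
      rw [Finset.sum_range_one, hE0, e3, hlR, hρ, zero_add, pow_one]
      have hN1 : NN k + 1 ≠ 0 := by positivity
      field_simp
      ring
    rw [e1, e2]
    exact hg
  have hwm : mass (wgt k ch) R = rho k * len R := by
    rw [show wgt k ch = _ from funext (wgt_eq k hk ch),
      step_mass k ch _ (fun i => by positivity) R hw.summable, hw.tsum_eq]
  have hwa : avg (wgt k ch) R = rho k := by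
    rw [avg, hwm, mul_div_assoc, div_self hlR0.ne', mul_one]
  have hσs : Summable fun i => (rho k ^ (i + 1))⁻¹ * volume.real (EE k ch i ∩ ivSet R) := by
    refine Summable.of_nonneg_of_le (fun i => by positivity) (fun i => ?_) hw.summable
    have h1 : 1 ≤ rho k ^ (i + 1) := one_le_pow₀ (by linarith)
    exact mul_le_mul_of_nonneg_right ((inv_le_one_of_one_le₀ h1).trans h1) measureReal_nonneg
  have hσm : (rho k)⁻¹ * (1 / (3 * NN k)) ≤ mass (sgm2 k ch) R := by
    rw [show sgm2 k ch = _ from funext (sgm2_eq k hk ch),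
      step_mass k ch _ (fun i => by positivity) R hσs]
    have := hσs.le_tsum 0 (fun i _ => by positivity)
    rw [hE0] at this
    simpa using this
  have hσa : (rho k)⁻¹ / 2 ≤ avg (sgm2 k ch) R := by
    rw [avg, le_div_iff₀ hlR0, hlR]
    refine le_trans (le_of_eq ?_) hσm
    field_simp
  refine ⟨?_, ?_⟩
  swap
  · rw [hwa]
    calc (1 / 1000 : ℝ) ≤ rho k * ((rho k)⁻¹ / 2) := by
          rw [← mul_div_assoc, mul_inv_cancel₀ hρ0.ne']; norm_num
      _ ≤ _ := by gcongr
  -- distribution function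
  obtain ⟨D, hDdef⟩ : ∃ D : ℝ → ℝ, D = fun t =>
      (volume {x | x ∈ ivSet R ∧ t < wgt k ch x}).toReal / len R := ⟨_, rfl⟩
  have hDsub : ∀ t, {x | x ∈ ivSet R ∧ t < wgt k ch x} ⊆ ivSet R := fun t x hx => hx.1
  have hDfin : ∀ t, volume {x | x ∈ ivSet R ∧ t < wgt k ch x} ≠ ⊤ := fun t =>
    ne_top_of_le_ne_top hfinR (measure_mono (hDsub t))
  have hD0 : ∀ t, 0 ≤ D t := fun t => by rw [hDdef]; positivity
  have hD1 : ∀ t, D t ≤ 1 := fun t => by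
    rw [hDdef]
    simp only
    rw [div_le_one hlR0, ← vol_iv R hlR0.le]
    exact measureReal_mono (hDsub t) hfinR
  have hDanti : Antitone D := by
    intro s t hst
    rw [hDdef]
    simp only
    refine div_le_div_of_nonneg_right ?_ hlR0.le
    exact measureReal_mono (fun x hx => ⟨hx.1, hst.trans_lt hx.2⟩) (hDfin s)
  have hup : ∀ n : ℕ, ∀ t, rho k ^ (n + 1) ≤ t → D t ≤ (1 / 3) ^ n / 2 := by
    intro n t ht
    have hsub : {x | x ∈ ivSet R ∧ t < wgt k ch x} ⊆ UU k (n + 1) ∩ ivSet R := by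
      rintro x ⟨hx, hxw⟩
      refine ⟨?_, hx⟩
      rw [wgt_eq k hk] at hxw
      by_cases h : ∃ i, x ∈ EE k ch i
      · obtain ⟨i, hi⟩ := h
        rw [step_mem k hk ch _ i x hi] at hxw
        have h2 : rho k ^ (n + 1) < rho k ^ (i + 1) := ht.trans_lt hxw
        have h3 := (pow_lt_pow_iff_right₀ (by linarith)).1 h2
        exact UU_anti k hk (by omega) (EE_sub k hk ch i hi)
      · push Not at h
        rw [step_nmem k ch _ x h] at hxw
        have : 0 < rho k ^ (n + 1) := by positivity
        linarith
    rw [hDdef]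
    simp only
    rw [div_le_iff₀ hlR0]
    refine (measureReal_mono hsub (ne_top_of_le_ne_top hfinR
      (measure_mono inter_subset_right))).trans ((hUs n).trans (le_of_eq ?_))
    rw [hlR]; field_simp
  have hlow : ∀ n : ℕ, ∀ t, t < rho k ^ (n + 1) → (1 / 3) ^ n / (2 * NN k) ≤ D t := by
    intro n t ht
    have hsub : EE k ch n ∩ ivSet R ⊆ {x | x ∈ ivSet R ∧ t < wgt k ch x} := by
      rintro x ⟨hx, hxR⟩
      refine ⟨hxR, ?_⟩
      rw [wgt_eq k hk, step_mem k hk ch _ n x hx]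
      exact ht
    rw [hDdef]
    simp only
    rw [le_div_iff₀ hlR0]
    refine le_trans ?_ (measureReal_mono hsub (hDfin t))
    cases n with
    | zero =>
      rw [hE0, hlR]
      rw [pow_zero, div_mul_div_comm, div_le_div_iff₀ (by positivity) (by positivity)]
      nlinarith
    | succ n =>
      rw [hEs n, hlR, pow_succ]
      apply le_of_eq
      field_simp
  have hint := analytic_int (rho k) (by linarith) hρ3 D hDanti hD0 hD1 hup
  have hfin := analytic_low (NN k) (3 ^ (k - 1)) hcastN hN2 (rho k) hρ D hD0 hD1 hint hlow
  have hlor : lorentz phi0 (wgt k ch) R = ∫ t in Ioi (0 : ℝ), phi0 (D t) := by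
    rw [lorentz, hDdef]
  rw [hlor, hwa, pow_eq k hk]
  refine le_trans ?_ hfin
  nlinarith

end RTpaper
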